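/- For every integer m ≥ 2, the minimum of the input entropy H^In_{2-Del}(y) of the binary 2-deletion channel over all channel outputs y ∈ Σ_2^m equals 2 + (3/4)·log₂ C(m+2, 2) − (1/2)·log₂(m+1), and it is attained exactly by the two constant words 0^m and 1^m (the words with a single run). -/

import Mathlib

open scoped Classical

noncomputable section

/-- The embedding number `ω_y(x)`: the number of distinct occurrences of `y`
as a subsequence of `x` (i.e. the number of index tuples realizing `y` in `x`). -/
def emb {q : ℕ} (y x : List (Fin q)) : ℕ := x.sublists.count y

/-- The run length profile of a word: the list of lengths of its maximal
blocks of identical consecutive symbols, in order. -/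
def runLengths {α : Type*} [DecidableEq α] : List α → List ℕ
  | [] => []
  | [_] => [1]
  | a :: b :: l =>
    if a = b then
      match runLengths (b :: l) with
      | [] => [1]
      | r :: rs => (r + 1) :: rs
    else 1 :: runLengths (b :: l)

/-- Input entropy `H^In_{k-Del}(y)` of the `k`-deletion channel over `Σ_q`
under uniform transmission, for a channel output `y ∈ Σ_q^{n-k}`:
`-∑_{x ∈ I_k(y)} p(x) log₂ p(x)` with `p(x) = ω_y(x) / (C(n,k) q^k)`. -/
def Hdel (q n k : ℕ) (y : Fin (n - k) → Fin q) : ℝ :=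
  - ∑ x ∈ Finset.univ.filter
      (fun x : Fin n → Fin q => (List.ofFn y).Sublist (List.ofFn x)),
      ((emb (List.ofFn y) (List.ofFn x) : ℝ) / ((n.choose k : ℝ) * (q : ℝ) ^ k)) *
        Real.logb 2 ((emb (List.ofFn y) (List.ofFn x) : ℝ) / ((n.choose k : ℝ) * (q : ℝ) ^ k))

/-- Input entropy `H^In_{k-Ins}(y)` of the `k`-insertion channel over `Σ_q`
under uniform transmission, for a channel output `y ∈ Σ_q^{n+k}`:
`-∑_{x ∈ D_k(y)} p(x) log₂ p(x)` with `p(x) = ω_x(y) / C(n+k,k)`. -/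
def Hins (q n k : ℕ) (y : Fin (n + k) → Fin q) : ℝ :=
  - ∑ x ∈ Finset.univ.filter
      (fun x : Fin n → Fin q => (List.ofFn x).Sublist (List.ofFn y)),
      ((emb (List.ofFn x) (List.ofFn y) : ℝ) / ((n + k).choose k : ℝ)) *
        Real.logb 2 ((emb (List.ofFn x) (List.ofFn y) : ℝ) / ((n + k).choose k : ℝ))

/-- A run length profile `rl` of a word of length `m` with `R` runs is balanced if it
consists of `m mod R` runs of length `⌈m/R⌉` and `R - (m mod R)` runs of length `⌊m/R⌋`. -/
def isBalanced (m R : ℕ) (rl : List ℕ) : Prop :=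
  rl.Perm (List.replicate (m % R) ((m + R - 1) / R) ++ List.replicate (R - m % R) (m / R))

/-- A run length profile `rl` of a word of length `m` with `R` runs is skewed if it
consists of `R - 1` runs of length `1` and a single run of length `m - (R-1)`. -/
def isSkewed (m R : ℕ) (rl : List ℕ) : Prop :=
  rl.Perm ((m - (R - 1)) :: List.replicate (R - 1) 1)

/-- `fIdx rl i` is the smallest (1-based) index `j ∈ [i+1, R]` with `r_j > 1`;
it is `R` if no such index exists, and `fIdx rl R = R`. -/
def fIdx (rl : List ℕ) (i : ℕ) : ℕ :=
  if i = rl.length then rl.length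
  else if {j | i + 1 ≤ j ∧ j ≤ rl.length ∧ 1 < rl.getD (j - 1) 0}.Nonempty
    then sInf {j | i + 1 ≤ j ∧ j ≤ rl.length ∧ 1 < rl.getD (j - 1) 0}
    else rl.length

/-- `bIdx rl i` is the largest (1-based) index `j ∈ [1, i]` with `r_j > 1`;
it is `1` if no such index exists, and `bIdx rl 0 = 1`. -/
def bIdx (rl : List ℕ) (i : ℕ) : ℕ :=
  if i = 0 then 1
  else if {j | 1 ≤ j ∧ j ≤ i ∧ 1 < rl.getD (j - 1) 0}.Nonempty
    then sSup {j | 1 ≤ j ∧ j ≤ i ∧ 1 < rl.getD (j - 1) 0}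
    else 1

/-- The function `t ↦ t log t`. -/
def xlogx (t : ℝ) : ℝ := t * Real.log t

/-- The defect of additivity of `t ↦ t log t`. -/
def defect (u v : ℝ) : ℝ := xlogx (u + v) - xlogx u - xlogx v

/-- The restriction `t ↦ (1 + t) log (1 + t) - t log t` of `defect` to the line `u = 1`. -/
def defectOne (t : ℝ) : ℝ := xlogx (1 + t) - xlogx t

@[simp] lemma xlogx_zero : xlogx 0 = 0 := by simp [xlogx]

@[simp] lemma xlogx_one : xlogx 1 = 0 := by simp [xlogx]

lemma defect_zero_left (v : ℝ) : defect 0 v = 0 := by simp [defect]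

lemma defect_one_left (v : ℝ) : defect 1 v = defectOne v := by simp [defect, defectOne]

lemma defect_mul {u c v : ℝ} (hu : 0 ≤ u) (hc : 0 < c) (hv : v = c * u) :
    defect u v = u * defectOne c := by
  subst hv
  rcases hu.eq_or_lt with rfl | hu
  · simp [defect]
  · have h : u + c * u = (1 + c) * u := by ring
    simp only [defect, defectOne, xlogx]
    rw [h, Real.log_mul (by positivity) hu.ne', Real.log_mul hc.ne' hu.ne']
    ring

lemma hasDerivAt_defectOne {t : ℝ} (ht : 0 < t) :
    HasDerivAt defectOne (Real.log (1 + t) - Real.log t) t := by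
  have h1 : HasDerivAt (fun t : ℝ => 1 + t) 1 t := (hasDerivAt_id t).const_add 1
  have h2 := (Real.hasDerivAt_mul_log (x := 1 + t) (by positivity)).comp t h1
  have h3 := h2.sub (Real.hasDerivAt_mul_log ht.ne')
  exact h3.congr_deriv (by ring)

lemma exists_defectOne_slope {a b : ℝ} (ha : 0 < a) (hab : a < b) :
    ∃ c, a < c ∧ c < b ∧
      defectOne b - defectOne a = (b - a) * (Real.log (1 + c) - Real.log c) := by
  obtain ⟨c, hc, h⟩ := exists_hasDerivAt_eq_slope defectOne
    (fun t => Real.log (1 + t) - Real.log t) hab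
    (fun t ht => (hasDerivAt_defectOne (ha.trans_le ht.1)).continuousAt.continuousWithinAt)
    (fun t ht => hasDerivAt_defectOne (ha.trans ht.1))
  refine ⟨c, hc.1, hc.2, ?_⟩
  have : b - a ≠ 0 := by linarith
  rw [h]
  field_simp

lemma le_defectOne_sub {a b : ℝ} (ha : 0 < a) (hab : a < b) :
    (b - a) / (1 + b) ≤ defectOne b - defectOne a := by
  obtain ⟨c, hac, hcb, h⟩ := exists_defectOne_slope ha hab
  have hc : 0 < c := ha.trans hac
  have h1 := Real.one_sub_inv_le_log_of_pos (x := (1 + c) / c) (by positivity)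
  rw [Real.log_div (by positivity) hc.ne', inv_div] at h1
  have h2 : 1 - c / (1 + c) = 1 / (1 + c) := by field_simp; ring
  have h3 : 1 / (1 + b) ≤ 1 / (1 + c) := one_div_le_one_div_of_le (by linarith) (by linarith)
  rw [h, div_eq_mul_one_div]
  exact mul_le_mul_of_nonneg_left (by linarith) (by linarith)

lemma defectOne_sub_le {a b : ℝ} (ha : 0 < a) (hab : a < b) :
    defectOne b - defectOne a ≤ (b - a) / a := by
  obtain ⟨c, hac, hcb, h⟩ := exists_defectOne_slope ha hab
  have hc : 0 < c := ha.trans hac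
  have h1 := Real.log_le_sub_one_of_pos (x := (1 + c) / c) (by positivity)
  rw [Real.log_div (by positivity) hc.ne'] at h1
  have h2 : (1 + c) / c - 1 = 1 / c := by field_simp; ring
  have h3 : 1 / c ≤ 1 / a := one_div_le_one_div_of_le ha hac.le
  rw [h, div_eq_mul_one_div]
  exact mul_le_mul_of_nonneg_left (by linarith) (by linarith)

lemma defectOne_lt {a b : ℝ} (ha : 0 < a) (hab : a < b) : defectOne a < defectOne b := by
  have h := le_defectOne_sub ha hab
  have : 0 < (b - a) / (1 + b) := div_pos (by linarith) (by linarith)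
  linarith

lemma defectOne_le {a b : ℝ} (ha : 0 < a) (hab : a ≤ b) : defectOne a ≤ defectOne b := by
  rcases hab.eq_or_lt with rfl | hab
  · rfl
  · exact (defectOne_lt ha hab).le

lemma defectOne_comb_step {N L : ℝ} (hL : 1 ≤ L) (hLN : L + 1 ≤ N) :
    (2 * N - L) * defectOne L + (L + 1) * defectOne (L / 2) ≤
      (2 * N - (L + 1)) * defectOne (L + 1) + (L + 1 + 1) * defectOne ((L + 1) / 2) := by
  have h1 := le_defectOne_sub (a := L) (b := L + 1) (by linarith) (by linarith)
  have h2 := le_defectOne_sub (a := L / 2) (b := (L + 1) / 2) (by linarith) (by linarith)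
  have h3 := defectOne_sub_le (a := L / 2) (b := L) (by linarith) (by linarith)
  have e1 : (L + 1 - L) / (1 + (L + 1)) = 1 / (L + 2) := by ring_nf
  have e2 : ((L + 1) / 2 - L / 2) / (1 + (L + 1) / 2) = 1 / (L + 3) := by field_simp; ring
  have e3 : (L - L / 2) / (L / 2) = 1 := by field_simp; ring
  rw [e1] at h1
  rw [e2] at h2
  rw [e3] at h3
  have h0 : 0 ≤ 1 / (L + 2) := by positivity
  have g1 : (L + 1) * (1 / (L + 2)) ≤ (2 * N - L - 1) * (defectOne (L + 1) - defectOne L) :=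
    mul_le_mul (by linarith) h1 h0 (by linarith)
  have g2 := mul_le_mul_of_nonneg_left h2 (by linarith : (0 : ℝ) ≤ L + 2)
  have g3 : 1 ≤ (L + 1) * (1 / (L + 2)) + (L + 2) * (1 / (L + 3)) := by
    rw [mul_one_div, mul_one_div, div_add_div _ _ (by positivity) (by positivity),
      one_le_div (by positivity)]
    nlinarith
  linarith

lemma defectOne_comb_le {N L : ℕ} (hL : 1 ≤ L) (hLN : L ≤ N) :
    (2 * N - L : ℝ) * defectOne L + (L + 1) * defectOne (L / 2) ≤
      N * defectOne N + (N + 1) * defectOne (N / 2) := by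
  induction hLN using Nat.decreasingInduction with
  | self => exact le_of_eq (by ring)
  | of_succ k hk ih =>
    refine (defectOne_comb_step (N := N) (L := k) (by exact_mod_cast hL)
      (by exact_mod_cast hk)).trans ?_
    have := ih (by omega)
    push_cast at this
    exact this

/-- The number of leading symbols of a word that are equal to `a`. -/
def lead (a : Fin 2) : List (Fin 2) → ℕ
  | [] => 0
  | b :: y => if b = a then lead a y + 1 else 0

lemma lead_le_length (a : Fin 2) (y : List (Fin 2)) : lead a y ≤ y.length := by
  induction y with
  | nil => simp [lead]
  | cons b y ih => simp only [lead, List.length_cons]; split_ifs <;> omega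

lemma eq_replicate_of_lead_eq {a : Fin 2} {y : List (Fin 2)} (h : lead a y = y.length) :
    y = List.replicate y.length a := by
  induction y with
  | nil => rfl
  | cons b y ih =>
    simp only [lead, List.length_cons] at h
    split_ifs at h with hb
    · rw [List.length_cons, List.replicate_succ, ← ih (by omega), hb]

lemma lead_replicate (a : Fin 2) (n : ℕ) : lead a (List.replicate n a) = n := by
  induction n with
  | zero => rfl
  | succ n ih => simp [List.replicate_succ, lead, ih]

lemma emb_nil_left {q : ℕ} (x : List (Fin q)) : emb [] x = 1 := by
  induction x with
  | nil => simp [emb]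
  | cons b x ih =>
    rw [emb, (List.sublists_perm_sublists' _).count_eq] at *
    rw [List.sublists'_cons, List.count_append, ih, List.count_eq_zero_of_not_mem (by simp)]

lemma emb_cons_nil {q : ℕ} (a : Fin q) (y : List (Fin q)) : emb (a :: y) [] = 0 := by
  rw [emb, List.count_eq_zero]
  simp

lemma emb_cons_cons {q : ℕ} (a b : Fin q) (y x : List (Fin q)) :
    emb (a :: y) (b :: x) = emb (a :: y) x + if a = b then emb y x else 0 := by
  simp only [emb, (List.sublists_perm_sublists' _).count_eq]
  rw [List.sublists'_cons, List.count_append]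
  congr 1
  split_ifs with h
  · subst h
    exact List.count_map_of_injective _ _ (List.cons_injective) _
  · rw [List.count_eq_zero]
    simp only [List.mem_map, not_exists, not_and]
    intro z _ hz
    exact h (List.cons.inj hz).1.symm

lemma emb_cons_self {q : ℕ} (a : Fin q) (y x : List (Fin q)) :
    emb (a :: y) (a :: x) = emb (a :: y) x + emb y x := by
  simp [emb_cons_cons]

lemma emb_cons_of_ne {q : ℕ} {a b : Fin q} (h : a ≠ b) (y x : List (Fin q)) :
    emb (a :: y) (b :: x) = emb (a :: y) x := by
  simp [emb_cons_cons, h]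

lemma emb_eq_zero_of_length_lt {q : ℕ} {y x : List (Fin q)} (h : x.length < y.length) :
    emb y x = 0 := by
  rw [emb, List.count_eq_zero, List.mem_sublists]
  exact fun hs => absurd hs.length_le (by omega)

lemma emb_eq_ite_of_length_eq {q : ℕ} {y x : List (Fin q)} (h : x.length = y.length) :
    emb y x = if x = y then 1 else 0 := by
  induction y generalizing x with
  | nil => simp [emb_nil_left, List.length_eq_zero_iff.mp h]
  | cons a y ih =>
    cases x with
    | nil => simp at h
    | cons b x =>
      simp only [List.length_cons, Nat.add_right_cancel_iff] at h
      rw [emb_cons_cons, emb_eq_zero_of_length_lt (by simp [h]), ih h]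
      by_cases hab : a = b <;> simp [hab, eq_comm]

lemma emb_self {q : ℕ} (y : List (Fin q)) : emb y y = 1 := by
  simp [emb_eq_ite_of_length_eq]

lemma emb_self_cons (a : Fin 2) (y : List (Fin 2)) : emb y (a :: y) = lead a y + 1 := by
  induction y with
  | nil => simp [emb_nil_left, lead]
  | cons b y ih =>
    by_cases h : b = a
    · subst h
      rw [emb_cons_self, emb_self, ih]
      simp [lead, add_comm]
    · rw [emb_cons_of_ne h, emb_self]
      simp [lead, h]

lemma emb_self_cons_cons (a : Fin 2) (y : List (Fin 2)) :
    emb y (a :: a :: y) = (lead a y + 2).choose 2 := by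
  induction y with
  | nil => simp [emb_nil_left, lead]
  | cons b y ih =>
    by_cases h : b = a
    · subst h
      rw [emb_cons_self, emb_self_cons, ih]
      simp only [lead, if_true]
      rw [Nat.choose_succ_succ' (lead b y + 2) 1, Nat.choose_one_right]
    · rw [emb_cons_of_ne h, emb_cons_of_ne h, emb_self]
      simp [lead, h]

lemma emb_self_cons_cons_le {a b : Fin 2} (hab : a ≠ b) (y : List (Fin 2)) :
    emb y (a :: b :: y) ≤ y.length + 1 := by
  induction y generalizing a b with
  | nil => simp [emb_nil_left]
  | cons c y ih =>
    by_cases h : c = a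
    · subst h
      rw [emb_cons_self, emb_cons_of_ne hab, emb_self]
      have := ih hab.symm
      simp only [List.length_cons]
      omega
    · rw [emb_cons_of_ne h, emb_self_cons]
      exact Nat.succ_le_succ (lead_le_length _ _)

lemma one_le_emb_self_cons_cons {a b : Fin 2} (y : List (Fin 2)) :
    1 ≤ emb y (a :: b :: y) := by
  rw [emb, List.one_le_count_iff, List.mem_sublists]
  exact ((List.Sublist.refl y).cons b).cons a

/-- The sum of `g` over all binary words of length `n`. -/
def wordSum (n : ℕ) (g : List (Fin 2) → ℝ) : ℝ := ∑ x : Fin n → Fin 2, g (List.ofFn x)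

lemma wordSum_zero (g : List (Fin 2) → ℝ) : wordSum 0 g = g [] := by
  simp [wordSum]

lemma wordSum_succ (a : Fin 2) (n : ℕ) (g : List (Fin 2) → ℝ) :
    wordSum (n + 1) g =
      wordSum n (fun x => g (a :: x)) + wordSum n (fun x => g ((a + 1) :: x)) := by
  have h : wordSum (n + 1) g = ∑ b : Fin 2, wordSum n (fun x => g (b :: x)) := by
    simp only [wordSum]
    rw [← (Fin.consEquiv fun _ : Fin (n + 1) => Fin 2).sum_comp, Fintype.sum_prod_type]
    simp [Fin.consEquiv, List.ofFn_succ]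
  rw [h]
  fin_cases a
  · simp
  · simp [add_comm]

lemma wordSum_congr {n : ℕ} {g g' : List (Fin 2) → ℝ}
    (h : ∀ x : List (Fin 2), x.length = n → g x = g' x) : wordSum n g = wordSum n g' :=
  Finset.sum_congr rfl fun _ _ => h _ (List.length_ofFn)

lemma wordSum_add (n : ℕ) (g g' : List (Fin 2) → ℝ) :
    wordSum n (fun x => g x + g' x) = wordSum n g + wordSum n g' :=
  Finset.sum_add_distrib

lemma wordSum_mul_const (n : ℕ) (g : List (Fin 2) → ℝ) (c : ℝ) :
    wordSum n (fun x => g x * c) = wordSum n g * c :=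
  (Finset.sum_mul _ _ _).symm

lemma wordSum_eq_add_sub {n : ℕ} {g g' : List (Fin 2) → ℝ} {w : List (Fin 2)}
    (hw : w.length = n) (h : ∀ x : List (Fin 2), x.length = n → x ≠ w → g x = g' x) :
    wordSum n g = wordSum n g' + (g w - g' w) := by
  subst hw
  have hof : List.ofFn w.get = w := List.ofFn_get w
  have : ∑ x : Fin w.length → Fin 2, (g (List.ofFn x) - g' (List.ofFn x)) = g w - g' w := by
    rw [Finset.sum_eq_single w.get, hof]
    · intro x _ hx
      rw [h _ List.length_ofFn, sub_self]
      intro hxw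
      exact hx (List.ofFn_injective (hxw.trans hof.symm))
    · simp
  rw [Finset.sum_sub_distrib] at this
  simp only [wordSum]
  linarith

lemma wordSum_eq_of_eq_zero {n : ℕ} {g : List (Fin 2) → ℝ} {w : List (Fin 2)}
    (hw : w.length = n) (h : ∀ x : List (Fin 2), x.length = n → x ≠ w → g x = 0) :
    wordSum n g = g w := by
  rw [wordSum_eq_add_sub (g' := fun _ => 0) hw h]
  simp [wordSum]

lemma ne_add_one (a : Fin 2) : a ≠ a + 1 := by fin_cases a <;> decide

lemma wordSum_emb (n : ℕ) (y : List (Fin 2)) :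
    wordSum n (fun x => (emb y x : ℝ)) = n.choose y.length * 2 ^ (n - y.length) := by
  induction n generalizing y with
  | zero =>
    rw [wordSum_zero]
    cases y with
    | nil => simp [emb_nil_left]
    | cons a y => simp [emb_cons_nil]
  | succ n ih =>
    cases y with
    | nil => simp [emb_nil_left, wordSum]
    | cons a y =>
      rw [wordSum_succ a]
      simp only [emb_cons_self, emb_cons_of_ne (ne_add_one a),
        Nat.cast_add]
      rw [wordSum_add, ih, ih]
      simp only [List.length_cons, Nat.choose_succ_succ' n y.length, Nat.cast_add,
        Nat.add_sub_add_right]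
      rcases Nat.lt_or_ge y.length n with h | h
      · rw [show n - y.length = n - (y.length + 1) + 1 by omega]
        ring
      · rw [Nat.choose_eq_zero_of_lt (show n < y.length + 1 by omega)]
        simp

/-- The sum of `defect u (s * u + v)` over all words `x` of length `|y| + 2`, where `u` and `v`
are the embedding numbers of `a :: y` and `y` in `x`. -/
def defectSum (s : ℝ) (a : Fin 2) (y : List (Fin 2)) : ℝ :=
  wordSum (y.length + 2) fun x => defect (emb (a :: y) x) (s * emb (a :: y) x + emb y x)

lemma wordSum_defect_emb (s : ℝ) (a b : Fin 2) (y : List (Fin 2)) :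
    wordSum (y.length + 1)
      (fun x => defect (emb (a :: y) x) (s * emb (a :: y) x + emb y (b :: x))) =
      defectOne (s + emb y (b :: a :: y)) := by
  rw [wordSum_eq_of_eq_zero (w := a :: y) (by simp)]
  · simp [emb_self, defect_one_left]
  · intro x hx hne
    rw [emb_eq_ite_of_length_eq (by simpa using hx), if_neg hne]
    simp [defect_zero_left]

lemma defectSum_of_lead_eq_zero {s : ℝ} (hs : 0 ≤ s) {a : Fin 2} {y : List (Fin 2)}
    (h : lead a y = 0) :
    defectSum s a y = (2 * y.length + 1) * defectOne (1 + s) + 2 * defectOne (s + 1 / 2) +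
      defectOne (s + emb y ((a + 1) :: a :: y)) := by
  have hy : ∀ x, emb y (a :: x) = emb y x := by
    intro x
    cases y with
    | nil => simp [emb_nil_left]
    | cons b y =>
      refine emb_cons_of_ne ?_ _ _
      rintro rfl
      simp [lead] at h
  rw [defectSum, wordSum_succ a]
  simp only [emb_cons_of_ne (ne_add_one a)]
  rw [wordSum_defect_emb]
  congr 1
  rw [wordSum_eq_add_sub (g' := fun x => emb y x * defectOne (1 + s)) (w := a :: y) (by simp),
    wordSum_mul_const, wordSum_emb]
  · rw [hy, emb_cons_self, emb_self, emb_self_cons, h]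
    rw [defect_mul (c := s + 1 / 2) (by positivity) (by positivity) (by push_cast; ring),
      show y.length + 1 - y.length = 1 by omega, Nat.choose_succ_self_right]
    push_cast
    ring
  · intro x hx hne
    rw [hy, emb_cons_self, emb_eq_ite_of_length_eq (y := a :: y) (by simpa using hx), if_neg hne,
      zero_add, defect_mul (c := 1 + s) (by positivity) (by positivity) (by ring)]

lemma defectSum_cons {s : ℝ} (hs : 0 ≤ s) (a : Fin 2) (y : List (Fin 2)) :
    defectSum s a (a :: y) = defectSum (s + 1) a y
      - (lead a y + 2) * defectOne (s + 1 + (lead a y + 1) / 2)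
      + (lead a y + 3) * defectOne (s + (lead a y + 2) / 2)
      + defectOne (lead a y + 2 + s) := by
  have hc : ((lead a y + 2).choose 2 : ℝ) = (lead a y + 2) * (lead a y + 1) / 2 := by
    rw [Nat.cast_choose_two]
    push_cast
    ring
  rw [defectSum, wordSum_succ a]
  simp only [emb_cons_of_ne (ne_add_one a)]
  have h2 := wordSum_defect_emb s a (a + 1) (a :: y)
  simp only [emb_cons_of_ne (ne_add_one a), emb_self_cons] at h2
  rw [show (a :: y).length + 1 = y.length + 2 from rfl] at *
  rw [h2]
  simp only [lead, if_true]
  rw [wordSum_eq_add_sub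
    (g' := fun x => defect (emb (a :: y) x) ((s + 1) * emb (a :: y) x + emb y x))
    (w := a :: a :: y) (by simp)]
  · rw [← defectSum]
    simp only [emb_cons_self a _ (a :: a :: y), emb_self, emb_self_cons, emb_self_cons_cons]
    simp only [lead, if_true, Nat.cast_add, hc]
    push_cast
    rw [defect_mul (c := s + (lead a y + 2) / 2) (by positivity) (by positivity) (by ring),
      defect_mul (c := s + 1 + (lead a y + 1) / 2) (by positivity) (by positivity) (by ring),
      show s + ((lead a y : ℝ) + 1 + 1) = lead a y + 2 + s by ring]
    ring
  · intro x hx hne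
    rw [emb_cons_self, emb_cons_self,
      emb_eq_ite_of_length_eq (y := a :: a :: y) (by simpa using hx), if_neg hne]
    push_cast
    congr 1 <;> ring

lemma defectSum_le {s : ℝ} (hs : 0 ≤ s) (a : Fin 2) (y : List (Fin 2)) :
    defectSum s a y ≤ (2 * y.length + 1 - lead a y) * defectOne (lead a y + 1 + s)
      + (lead a y + 2) * defectOne (s + (lead a y + 1) / 2) + defectOne (y.length + 1 + s) := by
  by_cases h : lead a y = 0
  · rw [defectSum_of_lead_eq_zero hs h, h]
    have h1 : (emb y ((a + 1) :: a :: y) : ℝ) ≤ y.length + 1 := by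
      exact_mod_cast emb_self_cons_cons_le (ne_add_one a).symm y
    have h2 : (1 : ℝ) ≤ emb y ((a + 1) :: a :: y) := by
      exact_mod_cast one_le_emb_self_cons_cons y
    have := defectOne_le (a := s + emb y ((a + 1) :: a :: y)) (b := y.length + 1 + s)
      (by linarith) (by linarith)
    simpa using this
  · cases y with
    | nil => simp [lead] at h
    | cons b y =>
      obtain rfl : b = a := by
        by_contra hb
        simp [lead, hb] at h
      have ih := defectSum_le (s := s + 1) (by positivity) b y
      rw [defectSum_cons hs]
      simp only [lead, if_true, List.length_cons]
      push_cast
      ring_nf at ih ⊢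
      linarith
termination_by y.length

lemma defectSum_replicate {s : ℝ} (hs : 0 ≤ s) (a : Fin 2) (n : ℕ) :
    defectSum s a (List.replicate n a) = (n + 1) * defectOne (n + 1 + s)
      + (n + 2) * defectOne (s + (n + 1) / 2) + defectOne (n + 1 + s) := by
  induction n generalizing s with
  | zero =>
    rw [List.replicate_zero, defectSum_of_lead_eq_zero hs rfl, emb_nil_left]
    simp [add_comm]
  | succ n ih =>
    rw [List.replicate_succ, defectSum_cons hs, ih (by positivity), lead_replicate]
    push_cast
    ring_nf

/-- The sum of `t log t` over the embedding numbers of `y` in all words of length `n`. -/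
def embSum (n : ℕ) (y : List (Fin 2)) : ℝ := wordSum n fun x => xlogx (emb y x)

lemma embSum_succ_cons (n : ℕ) (a : Fin 2) (y : List (Fin 2)) :
    embSum (n + 1) (a :: y) = 2 * embSum n (a :: y) + embSum n y +
      wordSum n (fun x => defect (emb (a :: y) x) (emb y x)) := by
  simp only [embSum]
  rw [wordSum_succ a]
  simp only [emb_cons_of_ne (ne_add_one a), emb_cons_self]
  rw [show (fun x => xlogx ((emb (a :: y) x + emb y x : ℕ) : ℝ)) = fun x =>
    xlogx (emb (a :: y) x) + (xlogx (emb y x) + defect (emb (a :: y) x) (emb y x)) by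
      funext x; simp only [defect]; push_cast; ring]
  rw [wordSum_add, wordSum_add]
  ring

lemma embSum_length (y : List (Fin 2)) : embSum y.length y = 0 := by
  rw [embSum, wordSum_eq_of_eq_zero (w := y) rfl]
  · simp [emb_self]
  · intro x hx hne
    simp [emb_eq_ite_of_length_eq hx, hne]

lemma embSum_one_cons (a : Fin 2) (y : List (Fin 2)) :
    embSum ((a :: y).length + 1) (a :: y) =
      embSum (y.length + 1) y + defectOne (lead a y + 1) := by
  rw [embSum_succ_cons, embSum_length, List.length_cons,
    wordSum_eq_of_eq_zero (w := a :: y) (by simp)]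
  · simp [emb_self, emb_self_cons, defect_one_left]
  · intro x hx hne
    rw [emb_eq_ite_of_length_eq (by simpa using hx), if_neg hne]
    simp [defect_zero_left]

lemma embSum_two_cons (a : Fin 2) (y : List (Fin 2)) :
    embSum ((a :: y).length + 2) (a :: y) =
      2 * embSum ((a :: y).length + 1) (a :: y) + embSum (y.length + 2) y + defectSum 0 a y := by
  rw [embSum_succ_cons]
  simp [defectSum]

lemma xlogx_succ (n : ℕ) : xlogx ((n + 1 : ℕ) + 1) = xlogx (n + 1) + defectOne (n + 1) := by
  simp only [defectOne]
  push_cast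
  rw [show (1 : ℝ) + (n + 1) = n + 1 + 1 by ring]
  ring

lemma embSum_one_le (y : List (Fin 2)) : embSum (y.length + 1) y ≤ xlogx (y.length + 1) := by
  induction y with
  | nil => simp [embSum, emb_nil_left, wordSum]
  | cons a y ih =>
    rw [embSum_one_cons, List.length_cons, xlogx_succ]
    have : (lead a y : ℝ) ≤ y.length := by exact_mod_cast lead_le_length a y
    exact add_le_add ih (defectOne_le (by positivity) (by linarith))

lemma embSum_one_lt {a : Fin 2} {y : List (Fin 2)} (h : y ≠ List.replicate y.length a) :
    embSum ((a :: y).length + 1) (a :: y) < xlogx ((a :: y).length + 1) := by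
  rw [embSum_one_cons, List.length_cons, xlogx_succ]
  have : (lead a y : ℝ) < y.length := by
    exact_mod_cast (lead_le_length a y).lt_of_ne fun he => h (eq_replicate_of_lead_eq he)
  exact add_lt_add_of_le_of_lt (embSum_one_le y) (defectOne_lt (by positivity) (by linarith))

lemma embSum_one_replicate (a : Fin 2) (n : ℕ) :
    embSum (n + 1) (List.replicate n a) = xlogx (n + 1) := by
  induction n with
  | zero => simp [embSum, emb_nil_left, wordSum]
  | succ n ih =>
    have := embSum_one_cons a (List.replicate n a)
    rw [lead_replicate] at this
    simp only [List.length_cons, List.length_replicate] at this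
    rw [List.replicate_succ, this, ih, xlogx_succ]

/-- The value of `embSum (n + 2)` at the constant words of length `n`. -/
def embSumTwoMax (n : ℕ) : ℝ :=
  (n + 2).choose 2 * (Real.log ((n + 2).choose 2) + 2 * Real.log (n + 1))

lemma embSumTwoMax_succ (n : ℕ) :
    embSumTwoMax (n + 1) = 2 * xlogx (n + 1 + 1) + embSumTwoMax n +
      ((n + 2) * defectOne (n + 1) + (n + 2) * defectOne ((n + 1) / 2)) := by
  have h1 : ((n + 2).choose 2 : ℝ) = (n + 1) / 2 * (n + 2) := by
    rw [Nat.cast_choose_two]; push_cast; ring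
  have h2 : ((n + 1 + 2).choose 2 : ℝ) = n + 2 + (n + 1) / 2 * (n + 2) := by
    rw [Nat.cast_choose_two]; push_cast; ring
  rw [← defect_mul (u := n + 2) (c := (n + 1) / 2) (by positivity) (by positivity) rfl]
  simp only [embSumTwoMax, h1, h2, defect, defectOne, xlogx]
  push_cast
  rw [show (1 : ℝ) + (n + 1) = n + 2 by ring, show (n : ℝ) + 1 + 1 = n + 2 by ring]
  ring

lemma defectSum_zero_le (a : Fin 2) (y : List (Fin 2)) :
    defectSum 0 a y ≤ (y.length + 2) * defectOne (y.length + 1)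
      + (y.length + 2) * defectOne ((y.length + 1) / 2) := by
  have h1 := defectSum_le le_rfl a y
  have h2 := defectOne_comb_le (N := y.length + 1) (L := lead a y + 1) (by omega)
    (by have := lead_le_length a y; omega)
  push_cast at h2
  simp only [add_zero, zero_add] at h1
  rw [show (2 * (y.length + 1) - (lead a y + 1) : ℝ) = 2 * y.length + 1 - lead a y by ring,
    show (lead a y + 1 + 1 : ℝ) = lead a y + 2 by ring,
    show (y.length + 1 + 1 : ℝ) = y.length + 2 by ring] at h2
  linarith

lemma embSum_two_le (y : List (Fin 2)) : embSum (y.length + 2) y ≤ embSumTwoMax y.length := by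
  induction y with
  | nil => simp [embSum, emb_nil_left, wordSum, embSumTwoMax]
  | cons a y ih =>
    have h1 := embSum_one_le (a :: y)
    have h2 := defectSum_zero_le a y
    rw [embSum_two_cons, List.length_cons, embSumTwoMax_succ]
    rw [List.length_cons] at h1
    push_cast at h1
    linarith

lemma embSum_two_lt {a : Fin 2} {y : List (Fin 2)} (h : y ≠ List.replicate y.length a) :
    embSum ((a :: y).length + 2) (a :: y) < embSumTwoMax (a :: y).length := by
  have h1 := embSum_one_lt h
  have h2 := defectSum_zero_le a y
  have h3 := embSum_two_le y
  rw [embSum_two_cons, List.length_cons, embSumTwoMax_succ]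
  rw [List.length_cons] at h1
  push_cast at h1
  linarith

lemma embSum_two_replicate (a : Fin 2) (n : ℕ) :
    embSum (n + 2) (List.replicate n a) = embSumTwoMax n := by
  induction n with
  | zero => simp [embSum, emb_nil_left, wordSum, embSumTwoMax]
  | succ n ih =>
    have h1 := embSum_two_cons a (List.replicate n a)
    have h2 := embSum_one_replicate a (n + 1)
    rw [defectSum_replicate le_rfl] at h1
    simp only [← List.replicate_succ, List.length_replicate] at h1
    rw [h1, h2, ih, embSumTwoMax_succ]
    push_cast
    simp only [add_zero, zero_add]
    ring

lemma Hdel_two_eq (m : ℕ) (y : Fin m → Fin 2) :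
    Hdel 2 (m + 2) 2 y =
      2 + Real.logb 2 ((m + 2).choose 2) -
        embSum (m + 2) (List.ofFn y) / ((m + 2).choose 2 * 4 * Real.log 2) := by
  have hC : (0 : ℝ) < (m + 2).choose 2 := by exact_mod_cast Nat.choose_pos (by omega)
  have hl : 0 < Real.log 2 := Real.log_pos (by norm_num)
  set T : ℝ := (m + 2).choose 2 * 4 with hT
  have hT0 : 0 < T := by positivity
  have hsum : wordSum (m + 2) (fun x => (emb (List.ofFn y) x : ℝ)) = T := by
    rw [wordSum_emb, List.length_ofFn, show m + 2 - m = 2 by omega,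
      Nat.choose_symm_of_eq_add (show m + 2 = m + 2 from rfl)]
    norm_num [hT]
  have hterm : ∀ k : ℕ, (k / T) * Real.logb 2 (k / T) =
      xlogx k * (1 / (T * Real.log 2)) + k * (- Real.log T / (T * Real.log 2)) := by
    intro k
    rcases Nat.eq_zero_or_pos k with rfl | hk
    · simp
    · have : (k : ℝ) ≠ 0 := by positivity
      rw [Real.logb, Real.log_div this hT0.ne', xlogx]
      field_simp
      ring
  have hH : Hdel 2 (m + 2) 2 y = - wordSum (m + 2) (fun x =>
      xlogx (emb (List.ofFn y) x) * (1 / (T * Real.log 2)) +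
        emb (List.ofFn y) x * (- Real.log T / (T * Real.log 2))) := by
    have hq : ((2 : ℕ) : ℝ) ^ 2 = 4 := by norm_num
    rw [Hdel, hq, ← hT, Finset.sum_filter_of_ne]
    · simp only [hterm]
      rfl
    · intro x _ hx
      by_contra hs
      refine hx ?_
      have : emb (List.ofFn y) (List.ofFn x) = 0 := by
        rw [emb, List.count_eq_zero, List.mem_sublists]
        exact hs
      erw [this]
      simp
  rw [hH, wordSum_add, wordSum_mul_const, wordSum_mul_const, hsum, ← embSum]
  have hlog : Real.log T = Real.log ((m + 2).choose 2) + 2 * Real.log 2 := by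
    rw [hT, Real.log_mul hC.ne' (by norm_num), show (4 : ℝ) = 2 ^ 2 by norm_num, Real.log_pow]
    norm_num
  rw [hlog, Real.logb]
  field_simp
  ring

lemma embSumTwoMax_entropy (m : ℕ) :
    2 + Real.logb 2 ((m + 2).choose 2) -
        embSumTwoMax m / ((m + 2).choose 2 * 4 * Real.log 2) =
      2 + (3 / 4 : ℝ) * Real.logb 2 ((m + 2).choose 2 : ℝ)
        - (1 / 2 : ℝ) * Real.logb 2 ((m : ℝ) + 1) := by
  have hC : (0 : ℝ) < (m + 2).choose 2 := by exact_mod_cast Nat.choose_pos (by omega)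
  have hl : 0 < Real.log 2 := Real.log_pos (by norm_num)
  simp only [embSumTwoMax, Real.logb]
  field_simp
  ring

lemma Hdel_two_const (m : ℕ) (a : Fin 2) :
    Hdel 2 (m + 2) 2 (fun _ : Fin m => a) =
      2 + (3 / 4 : ℝ) * Real.logb 2 ((m + 2).choose 2 : ℝ)
        - (1 / 2 : ℝ) * Real.logb 2 ((m : ℝ) + 1) := by
  rw [Hdel_two_eq, List.ofFn_const, embSum_two_replicate, embSumTwoMax_entropy]

lemma le_Hdel_two (m : ℕ) (y : Fin m → Fin 2) :
    2 + (3 / 4 : ℝ) * Real.logb 2 ((m + 2).choose 2 : ℝ)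
        - (1 / 2 : ℝ) * Real.logb 2 ((m : ℝ) + 1) ≤ Hdel 2 (m + 2) 2 y := by
  have h := embSum_two_le (List.ofFn y)
  rw [List.length_ofFn] at h
  rw [Hdel_two_eq, ← embSumTwoMax_entropy]
  gcongr

lemma lt_Hdel_two (m : ℕ) (y : Fin m → Fin 2) (hy : ∀ a, y ≠ fun _ => a) :
    2 + (3 / 4 : ℝ) * Real.logb 2 ((m + 2).choose 2 : ℝ)
        - (1 / 2 : ℝ) * Real.logb 2 ((m : ℝ) + 1) < Hdel 2 (m + 2) 2 y := by
  have h : embSum (m + 2) (List.ofFn y) < embSumTwoMax m := by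
    obtain _ | m := m
    · exact absurd (Subsingleton.elim _ _) (hy 0)
    · have hne : List.ofFn (fun i : Fin m => y i.succ) ≠
          List.replicate (List.ofFn (fun i : Fin m => y i.succ)).length (y 0) := by
        rw [List.length_ofFn, ← List.ofFn_const]
        intro he
        refine hy (y 0) (funext fun i => ?_)
        have hs := List.ofFn_injective he
        exact Fin.cases rfl (fun j => congrFun hs j) i
      have := embSum_two_lt hne
      rw [← List.ofFn_succ, List.length_ofFn] at this
      exact this
  rw [Hdel_two_eq, ← embSumTwoMax_entropy]
  have hC : (0 : ℝ) < (m + 2).choose 2 := by exact_mod_cast Nat.choose_pos (by omega)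
  have hl : 0 < Real.log 2 := Real.log_pos (by norm_num)
  gcongr

/-- For `m ≥ 2`, the minimum input entropy of the binary 2-deletion channel over all
channel outputs `y ∈ Σ_2^m` equals `2 + (3/4) log₂ C(m+2,2) - (1/2) log₂(m+1)`, and it
is attained exactly by the two constant words `0^m` and `1^m`. -/
theorem stmt_18 (m : ℕ) (hm : 2 ≤ m) :
    IsLeast ((fun y : Fin m → Fin 2 => Hdel 2 (m + 2) 2 y) '' Set.univ)
      (2 + (3 / 4 : ℝ) * Real.logb 2 ((m + 2).choose 2 : ℝ)
        - (1 / 2 : ℝ) * Real.logb 2 ((m : ℝ) + 1))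
    ∧ ∀ y : Fin m → Fin 2,
        (Hdel 2 (m + 2) 2 y =
            2 + (3 / 4 : ℝ) * Real.logb 2 ((m + 2).choose 2 : ℝ)
              - (1 / 2 : ℝ) * Real.logb 2 ((m : ℝ) + 1)
          ↔ y = (fun _ => 0) ∨ y = (fun _ => 1)) := by
  have hconst : ∀ a : Fin 2, Hdel 2 (m + 2) 2 (fun _ : Fin m => a) = _ := Hdel_two_const m
  refine ⟨⟨⟨fun _ => 0, Set.mem_univ _, hconst 0⟩, ?_⟩, fun y => ⟨fun h => ?_, ?_⟩⟩
  · rintro _ ⟨y, _, rfl⟩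
    exact le_Hdel_two m y
  · by_contra! hne
    refine (lt_Hdel_two m y fun a => ?_).ne' h
    fin_cases a
    · exact hne.1
    · exact hne.2
  · rintro (rfl | rfl)
    · exact hconst 0
    · exact hconst 1

end
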